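/- Let V ∈ C_0^∞(ℝ^n) be real-valued. Then for every integer j ≥ 1, every t > 0 and every x ∈ ℝ^n, Γ_j^V(t,x,x) = (-1)^j t^{j - n/2} ∫_{(ℝ^n)^j} ∫_{0 < s_j < … < s_1 < 1} [ ∏_{i=1}^j G(s_{i-1} - s_i, w_{i-1} - w_i) V(x + √t w_i) ] G(s_j, w_j) ds_1 … ds_j dw_1 … dw_j, with the conventions s_0 = 1 and w_0 = 0. -/

import Mathlib

open MeasureTheory Real

noncomputable def heatG (n : ℕ) (t : ℝ) (x : EuclideanSpace ℝ (Fin n)) : ℝ :=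
  (4 * Real.pi * t) ^ (-(n : ℝ) / 2) * Real.exp (-‖x‖ ^ 2 / (4 * t))

/-- The simplex `{0 < s_m < … < s_1 < 1}` (indices listed in decreasing order). -/
def simplex (m : ℕ) : Set (Fin m → ℝ) :=
  {s | StrictAnti s ∧ ∀ k, s k ∈ Set.Ioo (0 : ℝ) 1}

/-- `fnext s k = s (k+1)`, with the convention that it is `0` past the last index. -/
def fnext {m : ℕ} {E : Type*} [Zero E] (s : Fin m → E) (k : Fin m) : E :=
  if h : (k : ℕ) + 1 < m then s ⟨(k : ℕ) + 1, h⟩ else 0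

/-- `fprev dflt s k = s (k-1)`, with the convention that it is `dflt` at the first index. -/
def fprev {m : ℕ} {E : Type*} (dflt : E) (s : Fin m → E) (k : Fin m) : E :=
  if (k : ℕ) = 0 then dflt
  else s ⟨(k : ℕ) - 1, Nat.lt_of_le_of_lt (Nat.pred_le _) k.isLt⟩

/-- The iterated kernels `Γⱼ^V`, defined recursively by
`Γ₀^V(t,x,y) = G(t,x-y)` and
`Γ_{j+1}^V(t,x,y) = -∫_0^t ∫ G(t-s,x-z) V(z) Γⱼ^V(s,z,y) dz ds`. -/
noncomputable def Gam (n : ℕ) (V : EuclideanSpace ℝ (Fin n) → ℝ) :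
    ℕ → ℝ → EuclideanSpace ℝ (Fin n) → EuclideanSpace ℝ (Fin n) → ℝ
  | 0 => fun t x y => heatG n t (x - y)
  | j + 1 => fun t x y =>
      -∫ s in Set.Ioo (0 : ℝ) t, ∫ z : EuclideanSpace ℝ (Fin n),
        heatG n (t - s) (x - z) * V z * Gam n V j s z y

section HeatKernel

variable {n : ℕ}

lemma heatG_nonneg {t : ℝ} (ht : 0 < t) (x : EuclideanSpace ℝ (Fin n)) : 0 ≤ heatG n t x := by
  unfold heatG
  positivity

lemma Measurable.heatG {α : Type*} [MeasurableSpace α] {f : α → ℝ}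
    {g : α → EuclideanSpace ℝ (Fin n)} (hf : Measurable f) (hg : Measurable g) :
    Measurable fun a => heatG n (f a) (g a) := by
  unfold _root_.heatG
  fun_prop

lemma integral_heatG {t : ℝ} (ht : 0 < t) :
    ∫ x : EuclideanSpace ℝ (Fin n), heatG n t x = 1 := by
  have h := GaussianFourier.integral_rexp_neg_mul_sq_norm (V := EuclideanSpace ℝ (Fin n))
    (b := 1 / (4 * t)) (by positivity)
  have h' : ∀ x : EuclideanSpace ℝ (Fin n),
      heatG n t x = (4 * π * t) ^ (-(n : ℝ) / 2) * rexp (-(1 / (4 * t)) * ‖x‖ ^ 2) := by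
    intro x
    rw [heatG]
    congr 2
    ring
  simp_rw [h']
  rw [integral_const_mul, h, finrank_euclideanSpace_fin, div_div_eq_mul_div, div_one,
    neg_div, show π * (4 * t) = 4 * π * t by ring, ← rpow_add (by positivity),
    neg_add_cancel, rpow_zero]

lemma lintegral_heatG {t : ℝ} (ht : 0 < t) :
    ∫⁻ x : EuclideanSpace ℝ (Fin n), ENNReal.ofReal (heatG n t x) = 1 := by
  rw [← ofReal_integral_eq_lintegral_ofReal _ (.of_forall fun x => heatG_nonneg ht x),
    integral_heatG ht, ENNReal.ofReal_one]
  exact Integrable.of_integral_ne_zero (by rw [integral_heatG ht]; exact one_ne_zero)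

lemma heatG_mul_heatG {a b : ℝ} (ha : 0 < a) (hb : 0 < b) (x y z : EuclideanSpace ℝ (Fin n)) :
    heatG n a (x - z) * heatG n b (z - y) =
      heatG n (a + b) (x - y) *
        heatG n (a * b / (a + b)) (z - (a + b)⁻¹ • (b • x + a • y)) := by
  have hab : a + b ≠ 0 := by positivity
  have hm : z - (a + b)⁻¹ • (b • x + a • y) = (a + b)⁻¹ • (a • (z - y) - b • (x - z)) := by
    rw [eq_inv_smul_iff₀ hab, smul_sub, smul_inv_smul₀ hab]
    module
  rw [hm, show x - y = (x - z) + (z - y) by abel]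
  generalize x - z = u
  generalize z - y = v
  simp only [heatG]
  rw [mul_mul_mul_comm, mul_mul_mul_comm ((4 * π * (a + b)) ^ (-(n : ℝ) / 2)), ← exp_add,
    ← exp_add, ← mul_rpow (by positivity) (by positivity),
    ← mul_rpow (by positivity) (by positivity)]
  congr 2
  · field_simp
  · rw [norm_smul, mul_pow, norm_sub_sq_real, norm_add_sq_real, norm_smul, norm_smul,
      real_inner_smul_left, real_inner_smul_right, real_inner_comm u v, mul_pow, mul_pow,
      Real.norm_eq_abs, Real.norm_eq_abs, Real.norm_eq_abs, sq_abs, sq_abs, sq_abs]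
    field_simp
    ring

lemma lintegral_heatG_mul_heatG {a b : ℝ} (ha : 0 < a) (hb : 0 < b)
    (x y : EuclideanSpace ℝ (Fin n)) :
    ∫⁻ z, ENNReal.ofReal (heatG n a (x - z)) * ENNReal.ofReal (heatG n b (z - y)) =
      ENNReal.ofReal (heatG n (a + b) (x - y)) := by
  simp_rw [← ENNReal.ofReal_mul (heatG_nonneg ha _), heatG_mul_heatG ha hb,
    ENNReal.ofReal_mul (heatG_nonneg (add_pos ha hb) _)]
  rw [lintegral_const_mul' _ _ ENNReal.ofReal_ne_top,
    lintegral_sub_right_eq_self (fun z => ENNReal.ofReal (heatG n (a * b / (a + b)) z)),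
    lintegral_heatG (by positivity), mul_one]

lemma heatG_mul_sqrt_smul {t r : ℝ} (ht : 0 < t) (hr : 0 < r) (x : EuclideanSpace ℝ (Fin n)) :
    heatG n (t * r) (√t • x) = t ^ (-(n : ℝ) / 2) * heatG n r x := by
  rw [heatG, heatG, ← mul_assoc (t ^ _), ← mul_rpow (by positivity) (by positivity), norm_smul,
    mul_pow, Real.norm_eq_abs, sq_abs, sq_sqrt ht.le]
  congr 2
  · ring
  · field_simp

/-- Parabolic scaling of the iterated kernels. -/
lemma Gam_scale (V : EuclideanSpace ℝ (Fin n) → ℝ) {t : ℝ} (ht : 0 < t)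
    (x : EuclideanSpace ℝ (Fin n)) (j : ℕ) {r : ℝ} (hr : 0 < r) (a b : EuclideanSpace ℝ (Fin n)) :
    Gam n V j (t * r) (x + √t • a) (x + √t • b) =
      t ^ ((j : ℝ) - n / 2) * Gam n (fun w => V (x + √t • w)) j r a b := by
  induction j generalizing r a with
  | zero =>
    simp only [Gam]
    rw [add_sub_add_left_eq_sub, ← smul_sub, heatG_mul_sqrt_smul ht hr]
    simp [neg_div]
  | succ j ih =>
    have hspace (f : EuclideanSpace ℝ (Fin n) → ℝ) :
        ∫ z, f z = t ^ ((n : ℝ) / 2) * ∫ z, f (x + √t • z) := by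
      have hs : √t ^ n = t ^ ((n : ℝ) / 2) := by
        rw [sqrt_eq_rpow, ← rpow_natCast, ← rpow_mul ht.le]
        congr 1
        ring
      have hp : 0 < t ^ ((n : ℝ) / 2) := rpow_pos_of_pos ht _
      rw [Measure.integral_comp_smul volume (fun z => f (x + z)), integral_add_left_eq_self,
        finrank_euclideanSpace_fin, hs, abs_of_pos (inv_pos.2 hp), smul_eq_mul,
        mul_inv_cancel_left₀ hp.ne']
    have htime (f : ℝ → ℝ) :
        ∫ s in Set.Ioo 0 (t * r), f s = t * ∫ s in Set.Ioo 0 r, f (t * s) := by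
      have h := Measure.setIntegral_comp_smul_of_pos volume f (Set.Ioo 0 r) ht
      simp only [smul_eq_mul, Module.finrank_self, pow_one] at h
      rw [h, mul_inv_cancel_left₀ ht.ne', LinearOrderedField.smul_Ioo ht]
      simp
    simp only [Gam]
    rw [htime, mul_neg, ← integral_const_mul, ← integral_const_mul]
    congr 1
    refine setIntegral_congr_fun measurableSet_Ioo fun s hs => ?_
    rw [hspace, ← integral_const_mul, ← integral_const_mul, ← integral_const_mul]
    congr 1 with z
    rw [ih hs.1, ← mul_sub, add_sub_add_left_eq_sub, ← smul_sub,
      heatG_mul_sqrt_smul ht (sub_pos.2 hs.2)]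
    have : t ^ (((j + 1 : ℕ) : ℝ) - n / 2) =
        t * t ^ ((n : ℝ) / 2) * t ^ (-(n : ℝ) / 2) * t ^ ((j : ℝ) - n / 2) := by
      rw [← rpow_one_add' ht.le (by positivity), ← rpow_add ht, ← rpow_add ht]
      congr 1
      push_cast
      ring
    rw [this]
    ring

/-- The factor of the `j`-fold Duhamel integrand contributed by a first interaction at position
`p.1` and remaining time `p.2`. -/
noncomputable def duhamelStep (V : EuclideanSpace ℝ (Fin n) → ℝ) (t : ℝ)
    (x : EuclideanSpace ℝ (Fin n)) (p : EuclideanSpace ℝ (Fin n) × ℝ) : ℝ :=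
  (Set.Ioo 0 t).indicator (fun s => heatG n (t - s) (x - p.1) * V p.1) p.2

/-- The integrand of `(-1) ^ j * Gam n V j t x y` over the `j` interaction points. -/
noncomputable def duhamelIntegrand (V : EuclideanSpace ℝ (Fin n) → ℝ) :
    (j : ℕ) → ℝ → EuclideanSpace ℝ (Fin n) → EuclideanSpace ℝ (Fin n) →
      (Fin j → EuclideanSpace ℝ (Fin n) × ℝ) → ℝ
  | 0 => fun t x y _ => heatG n t (x - y)
  | j + 1 => fun t x y q =>
      duhamelStep V t x (q 0) * duhamelIntegrand V j (q 0).2 (q 0).1 y fun i => q i.succ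

variable {V : EuclideanSpace ℝ (Fin n) → ℝ}

lemma measurable_duhamelStep (hV : Measurable V) :
    Measurable fun p : (ℝ × EuclideanSpace ℝ (Fin n)) × (EuclideanSpace ℝ (Fin n) × ℝ) =>
      duhamelStep V p.1.1 p.1.2 p.2 := by
  have hset : MeasurableSet
      {p : (ℝ × EuclideanSpace ℝ (Fin n)) × (EuclideanSpace ℝ (Fin n) × ℝ) |
        0 < p.2.2 ∧ p.2.2 < p.1.1} := by
    measurability
  have hG : Measurable fun p : (ℝ × EuclideanSpace ℝ (Fin n)) × (EuclideanSpace ℝ (Fin n) × ℝ) =>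
      heatG n (p.1.1 - p.2.2) (p.1.2 - p.2.1) :=
    Measurable.heatG (by fun_prop) (by fun_prop)
  exact (hG.mul (hV.comp (by fun_prop : Measurable fun p :
    (ℝ × EuclideanSpace ℝ (Fin n)) × (EuclideanSpace ℝ (Fin n) × ℝ) => p.2.1))).indicator hset

lemma measurable_duhamelIntegrand (hV : Measurable V) (y : EuclideanSpace ℝ (Fin n)) (j : ℕ) :
    Measurable fun p :
        (ℝ × EuclideanSpace ℝ (Fin n)) × (Fin j → EuclideanSpace ℝ (Fin n) × ℝ) =>
      duhamelIntegrand V j p.1.1 p.1.2 y p.2 := by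
  induction j with
  | zero =>
    exact Measurable.heatG (by fun_prop) (by fun_prop)
  | succ j ih =>
    exact ((measurable_duhamelStep hV).comp (f := fun p :
        (ℝ × EuclideanSpace ℝ (Fin n)) × (Fin (j + 1) → EuclideanSpace ℝ (Fin n) × ℝ) =>
          (p.1, p.2 0)) (by fun_prop)).mul
      (ih.comp (f := fun p :
        (ℝ × EuclideanSpace ℝ (Fin n)) × (Fin (j + 1) → EuclideanSpace ℝ (Fin n) × ℝ) =>
          (((p.2 0).2, (p.2 0).1), fun i : Fin j => p.2 i.succ)) (by fun_prop))

lemma measurable_duhamelIntegrand_succ_split (hV : Measurable V) (j : ℕ) (t : ℝ)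
    (x y : EuclideanSpace ℝ (Fin n)) :
    Measurable fun p : (EuclideanSpace ℝ (Fin n) × ℝ) ×
        (Fin j → EuclideanSpace ℝ (Fin n) × ℝ) =>
      duhamelStep V t x p.1 * duhamelIntegrand V j p.1.2 p.1.1 y p.2 :=
  ((measurable_duhamelStep hV).comp (f := fun p : (EuclideanSpace ℝ (Fin n) × ℝ) ×
      (Fin j → EuclideanSpace ℝ (Fin n) × ℝ) => ((t, x), p.1)) (by fun_prop)).mul
    ((measurable_duhamelIntegrand hV y j).comp (f := fun p : (EuclideanSpace ℝ (Fin n) × ℝ) ×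
      (Fin j → EuclideanSpace ℝ (Fin n) × ℝ) => ((p.1.2, p.1.1), p.2)) (by fun_prop))

lemma enorm_duhamelStep_le {M : NNReal} (hM : ∀ z, ‖V z‖₊ ≤ M) (t : ℝ)
    (x : EuclideanSpace ℝ (Fin n)) (p : EuclideanSpace ℝ (Fin n) × ℝ) :
    ‖duhamelStep V t x p‖ₑ ≤
      (Set.Ioo 0 t).indicator (fun s => M * ENNReal.ofReal (heatG n (t - s) (x - p.1))) p.2 := by
  unfold duhamelStep
  by_cases h : p.2 ∈ Set.Ioo 0 t
  · rw [Set.indicator_of_mem h, Set.indicator_of_mem h, enorm_mul, mul_comm,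
      Real.enorm_of_nonneg (heatG_nonneg (sub_pos.2 h.2) _)]
    gcongr
    exact ENNReal.coe_le_coe.2 (hM _)
  · simp [Set.indicator_of_notMem h]

lemma lintegral_duhamelIntegrand_le (hV : Measurable V) {M : NNReal} (hM : ∀ z, ‖V z‖₊ ≤ M)
    {T : ℝ} (y : EuclideanSpace ℝ (Fin n)) (j : ℕ) {t : ℝ} (ht : 0 < t) (htT : t ≤ T)
    (x : EuclideanSpace ℝ (Fin n)) :
    ∫⁻ q, ‖duhamelIntegrand V j t x y q‖ₑ ≤
      (M * ENNReal.ofReal T) ^ j * ENNReal.ofReal (heatG n t (x - y)) := by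
  induction j generalizing t x with
  | zero =>
    simp [duhamelIntegrand, Real.enorm_of_nonneg (heatG_nonneg ht _), volume_pi]
  | succ j ih =>
    set C : ENNReal := (M * ENNReal.ofReal T) ^ j
    have hC : C ≠ ⊤ := ENNReal.pow_ne_top (ENNReal.mul_ne_top ENNReal.coe_ne_top
      ENNReal.ofReal_ne_top)
    have hmeas := (measurable_duhamelIntegrand_succ_split hV j t x y).enorm
    calc ∫⁻ q, ‖duhamelIntegrand V (j + 1) t x y q‖ₑ
        = ∫⁻ p : (EuclideanSpace ℝ (Fin n) × ℝ) × (Fin j → EuclideanSpace ℝ (Fin n) × ℝ),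
            ‖duhamelStep V t x p.1 * duhamelIntegrand V j p.1.2 p.1.1 y p.2‖ₑ :=
          (volume_preserving_piFinSuccAbove (fun _ : Fin (j + 1) =>
            EuclideanSpace ℝ (Fin n) × ℝ) 0).lintegral_comp hmeas
      _ = ∫⁻ p, ‖duhamelStep V t x p‖ₑ * ∫⁻ q, ‖duhamelIntegrand V j p.2 p.1 y q‖ₑ := by
          rw [Measure.volume_eq_prod, lintegral_prod _ hmeas.aemeasurable]
          simp_rw [enorm_mul]
          congr 1 with p
          exact lintegral_const_mul' _ _ enorm_ne_top
      _ ≤ ∫⁻ p : EuclideanSpace ℝ (Fin n) × ℝ, (Set.Ioo 0 t).indicator (fun s => M * C *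
            (ENNReal.ofReal (heatG n (t - s) (x - p.1)) *
              ENNReal.ofReal (heatG n s (p.1 - y)))) p.2 := by
          refine lintegral_mono fun p => ?_
          have hstep := enorm_duhamelStep_le hM t x p
          by_cases h : p.2 ∈ Set.Ioo 0 t
          · rw [Set.indicator_of_mem h] at hstep ⊢
            calc _ ≤ _ := mul_le_mul' hstep (ih h.1 (h.2.le.trans htT) p.1)
              _ = _ := by ring
          · rw [Set.indicator_of_notMem h] at hstep ⊢
            rw [nonpos_iff_eq_zero.1 hstep, zero_mul]
      _ ≤ ∫⁻ s, ∫⁻ z, (Set.Ioo 0 t).indicator (fun s => M * C *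
            (ENNReal.ofReal (heatG n (t - s) (x - z)) *
              ENNReal.ofReal (heatG n s (z - y)))) s := by
          rw [Measure.volume_eq_prod, ← lintegral_prod_swap]
          exact lintegral_prod_le _
      _ = ∫⁻ s in Set.Ioo 0 t, M * C * ENNReal.ofReal (heatG n t (x - y)) := by
          rw [← lintegral_indicator measurableSet_Ioo]
          congr 1 with s
          by_cases h : s ∈ Set.Ioo 0 t
          · simp_rw [Set.indicator_of_mem h]
            rw [lintegral_const_mul' _ _ (ENNReal.mul_ne_top ENNReal.coe_ne_top hC),
              lintegral_heatG_mul_heatG (sub_pos.2 h.2) h.1, sub_add_cancel]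
          · simp [Set.indicator_of_notMem h]
      _ = M * C * ENNReal.ofReal (heatG n t (x - y)) * ENNReal.ofReal t := by
          rw [setLIntegral_const, Real.volume_Ioo, sub_zero]
      _ ≤ M * C * ENNReal.ofReal (heatG n t (x - y)) * ENNReal.ofReal T := by gcongr
      _ = _ := by rw [pow_succ]; ring

lemma integrable_duhamelIntegrand (hV : Measurable V) {M : NNReal} (hM : ∀ z, ‖V z‖₊ ≤ M)
    (j : ℕ) {t : ℝ} (ht : 0 < t) (x y : EuclideanSpace ℝ (Fin n)) :
    Integrable (duhamelIntegrand V j t x y) := by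
  refine ⟨((measurable_duhamelIntegrand hV y j).comp (f := fun q => ((t, x), q))
    (by fun_prop)).aestronglyMeasurable, ?_⟩
  refine (lintegral_duhamelIntegrand_le hV hM y j ht le_rfl x).trans_lt ?_
  exact ENNReal.mul_lt_top (ENNReal.pow_lt_top (ENNReal.mul_lt_top ENNReal.coe_lt_top
    ENNReal.ofReal_lt_top)) ENNReal.ofReal_lt_top

lemma Gam_eq_integral_duhamelIntegrand (hV : Measurable V) {M : NNReal}
    (hM : ∀ z, ‖V z‖₊ ≤ M) (j : ℕ) {t : ℝ} (ht : 0 < t) (x y : EuclideanSpace ℝ (Fin n)) :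
    Gam n V j t x y = (-1) ^ j * ∫ q, duhamelIntegrand V j t x y q := by
  induction j generalizing t x with
  | zero => simp [Gam, duhamelIntegrand, volume_pi, measureReal_def]
  | succ j ih =>
    have hmp := volume_preserving_piFinSuccAbove (fun _ : Fin (j + 1) =>
      EuclideanSpace ℝ (Fin n) × ℝ) 0
    have hint : Integrable fun p : (EuclideanSpace ℝ (Fin n) × ℝ) ×
        (Fin j → EuclideanSpace ℝ (Fin n) × ℝ) =>
          duhamelStep V t x p.1 * duhamelIntegrand V j p.1.2 p.1.1 y p.2 :=
      (hmp.integrable_comp_emb (MeasurableEquiv.measurableEmbedding _)).1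
        (integrable_duhamelIntegrand hV hM (j + 1) ht x y)
    have hsplit : ∫ q, duhamelIntegrand V (j + 1) t x y q =
        ∫ p : (EuclideanSpace ℝ (Fin n) × ℝ) × (Fin j → EuclideanSpace ℝ (Fin n) × ℝ),
          duhamelStep V t x p.1 * duhamelIntegrand V j p.1.2 p.1.1 y p.2 :=
      hmp.integral_comp' (g := fun p : (EuclideanSpace ℝ (Fin n) × ℝ) ×
        (Fin j → EuclideanSpace ℝ (Fin n) × ℝ) =>
          duhamelStep V t x p.1 * duhamelIntegrand V j p.1.2 p.1.1 y p.2)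
    rw [hsplit, Measure.volume_eq_prod, integral_prod _ hint, Measure.volume_eq_prod,
      integral_prod_symm _ hint.integral_prod_left]
    simp only [Gam]
    rw [← integral_indicator measurableSet_Ioo, pow_succ, mul_neg_one, neg_mul, ← integral_const_mul]
    congr 2 with s
    rw [← integral_const_mul]
    by_cases h : s ∈ Set.Ioo 0 t
    · rw [Set.indicator_of_mem h]
      congr 1 with z
      simp only [duhamelStep]
      rw [ih h.1, integral_const_mul, Set.indicator_of_mem h]
      ring
    · simp [duhamelStep, Set.indicator_of_notMem h]

lemma fprev_succ {m : ℕ} {E : Type*} (d : E) (s : Fin (m + 1) → E) (i : Fin m) :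
    fprev d s i.succ = fprev (s 0) (fun k => s k.succ) i := by
  rcases i with ⟨_ | i, hi⟩ <;> rfl

lemma strictAnti_forall_mem_Ioo_succ_iff {m : ℕ} (t : ℝ) (s : Fin (m + 2) → ℝ) :
    (StrictAnti s ∧ ∀ k, s k ∈ Set.Ioo 0 t) ↔
      s 0 ∈ Set.Ioo 0 t ∧ StrictAnti (fun k : Fin (m + 1) => s k.succ) ∧
        ∀ k : Fin (m + 1), s k.succ ∈ Set.Ioo 0 (s 0) := by
  constructor
  · rintro ⟨ha, hs⟩
    exact ⟨hs 0, fun i k h => ha (Fin.succ_lt_succ_iff.2 h),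
      fun k => ⟨(hs _).1, ha (Fin.succ_pos k)⟩⟩
  · rintro ⟨h0, ha, hs⟩
    refine ⟨fun i k hik => ?_, fun k => ?_⟩
    · cases k using Fin.cases with
      | zero => exact absurd hik (Fin.not_lt_zero i)
      | succ k =>
        cases i using Fin.cases with
        | zero => exact (hs k).2
        | succ i => exact ha (Fin.succ_lt_succ_iff.1 hik)
    · cases k using Fin.cases with
      | zero => exact h0
      | succ k => exact ⟨(hs k).1, (hs k).2.trans h0.2⟩

lemma duhamelIntegrand_eq_indicator (V : EuclideanSpace ℝ (Fin n) → ℝ) (j : ℕ) (t : ℝ)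
    (x y : EuclideanSpace ℝ (Fin n)) (w : Fin (j + 1) → EuclideanSpace ℝ (Fin n))
    (s : Fin (j + 1) → ℝ) :
    duhamelIntegrand V (j + 1) t x y (fun i => (w i, s i)) =
      {s : Fin (j + 1) → ℝ | StrictAnti s ∧ ∀ k, s k ∈ Set.Ioo 0 t}.indicator
        (fun s => (∏ i, heatG n (fprev t s i - s i) (fprev x w i - w i) * V (w i)) *
          heatG n (s (Fin.last j)) (w (Fin.last j) - y)) s := by
  induction j generalizing t x with
  | zero =>
    have : s ∈ {s : Fin 1 → ℝ | StrictAnti s ∧ ∀ k, s k ∈ Set.Ioo 0 t} ↔ s 0 ∈ Set.Ioo 0 t := by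
      simp [Subsingleton.strictAnti]
    by_cases h : s 0 ∈ Set.Ioo 0 t
    · rw [Set.indicator_of_mem (this.2 h)]
      simp [duhamelIntegrand, duhamelStep, Set.indicator_of_mem h, fprev]
    · rw [Set.indicator_of_notMem (mt this.1 h)]
      simp [duhamelIntegrand, duhamelStep, Set.indicator_of_notMem h]
  | succ j ih =>
    change duhamelStep V t x (w 0, s 0) *
      duhamelIntegrand V (j + 1) (s 0) (w 0) y (fun i => (w i.succ, s i.succ)) = _
    rw [ih _ _ (fun i => w i.succ) fun i => s i.succ, duhamelStep]
    simp only [Set.indicator, Set.mem_ofPred_eq, strictAnti_forall_mem_Ioo_succ_iff (m := j) t s]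
    by_cases h : s 0 ∈ Set.Ioo 0 t
    · simp only [h, if_true, true_and, mul_ite, mul_zero]
      congr 1
      rw [Fin.prod_univ_succ (n := j + 1)]
      simp only [fprev_succ, Fin.succ_last]
      simp [fprev, mul_assoc]
    · simp [h]

lemma measurableSet_simplex (m : ℕ) : MeasurableSet (simplex m) := by
  have : simplex m = (⋂ (i) (k) (_ : i < k), {s | s k < s i}) ∩
      ⋂ k, {s | s k ∈ Set.Ioo (0 : ℝ) 1} := by
    ext s
    simp [simplex, StrictAnti]
  rw [this]
  refine .inter (.iInter fun i => .iInter fun k => .iInter fun _ =>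
    measurableSet_lt (by fun_prop) (by fun_prop)) (.iInter fun k => ?_)
  exact measurableSet_Ioo.preimage (measurable_pi_apply k)

end HeatKernel

/-- For every `j ≥ 1` (here tuples of length `j+1`, `j : ℕ`): scaling identity for
`Γ_{j+1}^V(t,x,x)`, with the conventions `s₀ = 1`, `w₀ = 0`. -/
theorem Gam_diag_eq (n : ℕ) (V : EuclideanSpace ℝ (Fin n) → ℝ)
    (hV : ContDiff ℝ (⊤ : ℕ∞) V) (hcpt : HasCompactSupport V)
    (j : ℕ) (t : ℝ) (ht : 0 < t) (x : EuclideanSpace ℝ (Fin n)) :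
    Gam n V (j + 1) t x x =
      (-1 : ℝ) ^ (j + 1) * t ^ ((j + 1 : ℝ) - (n : ℝ) / 2) *
        ∫ w : Fin (j + 1) → EuclideanSpace ℝ (Fin n),
          ∫ s in simplex (j + 1),
            (∏ i, heatG n (fprev 1 s i - s i) (fprev 0 w i - w i) *
                V (x + Real.sqrt t • w i)) *
              heatG n (s (Fin.last j)) (w (Fin.last j)) := by
  have hVc : Continuous fun w => V (x + √t • w) := hV.continuous.comp (by fun_prop)
  obtain ⟨M, hM⟩ := hcpt.exists_bound_of_continuous hV.continuous
  have hM' : ∀ w, ‖V (x + √t • w)‖₊ ≤ M.toNNReal := fun w =>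
    NNReal.coe_le_coe.1 ((hM _).trans (Real.le_coe_toNNReal M))
  have hscale := Gam_scale V ht x (j + 1) one_pos 0 0
  rw [mul_one, smul_zero, add_zero] at hscale
  have hmp := volume_measurePreserving_arrowProdEquivProdArrow (EuclideanSpace ℝ (Fin n)) ℝ
    (Fin (j + 1))
  have hint := integrable_duhamelIntegrand hVc.measurable hM' (j + 1) one_pos 0 0
  have hint' := (hmp.symm.integrable_comp_emb (MeasurableEquiv.measurableEmbedding _)).2 hint
  rw [hscale, Gam_eq_integral_duhamelIntegrand hVc.measurable hM' (j + 1) one_pos,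
    ← hmp.symm.integral_comp', Measure.volume_eq_prod, integral_prod (fun p => duhamelIntegrand (fun w => V (x + √t • w)) (j + 1) 1 0 0
      ((MeasurableEquiv.arrowProdEquivProdArrow _ _ _).symm p)) hint',
    ← mul_assoc, mul_comm (t ^ _), Nat.cast_add_one]
  congr 2 with w
  rw [← integral_indicator (measurableSet_simplex _)]
  congr 1 with s
  refine (duhamelIntegrand_eq_indicator (fun w => V (x + √t • w)) j 1 0 0 w s).trans ?_
  simp only [sub_zero, simplex]
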